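/- Let α, β, γ, δ, c, ε be real constants with γ ≠ 0. Suppose U, W : ℝ × ℝ → ℝ are four times continuously differentiable and satisfy the potential coupled Boussinesq system at every point. Then the local mass conservation law holds at every point: ∂_t( U_t + (δ/γ) W_t ) − ∂_x( U_x + (δc²/γ) W_x + (ε/2) U_x² + (εαδ/(2γ)) W_x² + ε U_ttx + (εβδ/γ) W_ttx ) = 0. -/

import Mathlib

/-- Partial derivative in the first variable (space `x`). -/
noncomputable def pd1 (f : ℝ → ℝ → ℝ) (x y : ℝ) : ℝ := deriv (fun x' => f x' y) x

/-- Partial derivative in the second variable (time `t`). -/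
noncomputable def pd2 (f : ℝ → ℝ → ℝ) (x y : ℝ) : ℝ := deriv (fun y' => f x y') y

/-- The potential coupled Boussinesq system:
`U_tt − U_xx = ε[ U_x U_xx + U_ttxx − δ(U − W) ]`,
`W_tt − c² W_xx = ε[ α W_x W_xx + β W_ttxx + γ(U − W) ]`. -/
def potCB (α β γ δ c ε : ℝ) (U W : ℝ → ℝ → ℝ) : Prop :=
  ∀ x t : ℝ,
    pd2 (pd2 U) x t - pd1 (pd1 U) x t
      = ε * (pd1 U x t * pd1 (pd1 U) x t + pd1 (pd1 (pd2 (pd2 U))) x t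
          - δ * (U x t - W x t)) ∧
    pd2 (pd2 W) x t - c ^ 2 * pd1 (pd1 W) x t
      = ε * (α * pd1 W x t * pd1 (pd1 W) x t + β * pd1 (pd1 (pd2 (pd2 W))) x t
          + γ * (U x t - W x t))

theorem hasDerivAt_fst {f : ℝ → ℝ → ℝ} {n : WithTop ℕ∞}
    (hf : ContDiff ℝ n (Function.uncurry f)) (hn : n ≠ 0) (x y : ℝ) :
    HasDerivAt (fun x' => f x' y) (fderiv ℝ (Function.uncurry f) (x, y) (1, 0)) x :=
  HasFDerivAt.comp_hasDerivAt (l := Function.uncurry f)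
    (f := fun x' => (x', y)) x
    (hf.differentiable hn (x, y)).hasFDerivAt
    ((hasDerivAt_id x).prodMk (hasDerivAt_const x y))

theorem hasDerivAt_snd {f : ℝ → ℝ → ℝ} {n : WithTop ℕ∞}
    (hf : ContDiff ℝ n (Function.uncurry f)) (hn : n ≠ 0) (x y : ℝ) :
    HasDerivAt (fun y' => f x y') (fderiv ℝ (Function.uncurry f) (x, y) (0, 1)) y :=
  HasFDerivAt.comp_hasDerivAt (l := Function.uncurry f)
    (f := fun y' => (x, y')) y
    (hf.differentiable hn (x, y)).hasFDerivAt
    ((hasDerivAt_const y x).prodMk (hasDerivAt_id y))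

theorem hasDerivAt_pd1 {f : ℝ → ℝ → ℝ} {n : WithTop ℕ∞}
    (hf : ContDiff ℝ n (Function.uncurry f)) (hn : n ≠ 0) (x y : ℝ) :
    HasDerivAt (fun x' => f x' y) (pd1 f x y) x :=
  (hasDerivAt_fst hf hn x y).differentiableAt.hasDerivAt

theorem hasDerivAt_pd2 {f : ℝ → ℝ → ℝ} {n : WithTop ℕ∞}
    (hf : ContDiff ℝ n (Function.uncurry f)) (hn : n ≠ 0) (x y : ℝ) :
    HasDerivAt (fun y' => f x y') (pd2 f x y) y :=
  (hasDerivAt_snd hf hn x y).differentiableAt.hasDerivAt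

theorem contDiff_uncurry_pd1 {f : ℝ → ℝ → ℝ} {m n : WithTop ℕ∞}
    (hf : ContDiff ℝ n (Function.uncurry f)) (hmn : m + 1 ≤ n) :
    ContDiff ℝ m (Function.uncurry (pd1 f)) := by
  have hn : n ≠ 0 := by rintro rfl; simp at hmn
  have h : Function.uncurry (pd1 f) = fun p => fderiv ℝ (Function.uncurry f) p (1, 0) :=
    funext fun p => (hasDerivAt_fst hf hn p.1 p.2).deriv
  rw [h]
  exact (hf.fderiv_right hmn).clm_apply contDiff_const

theorem contDiff_uncurry_pd2 {f : ℝ → ℝ → ℝ} {m n : WithTop ℕ∞}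
    (hf : ContDiff ℝ n (Function.uncurry f)) (hmn : m + 1 ≤ n) :
    ContDiff ℝ m (Function.uncurry (pd2 f)) := by
  have hn : n ≠ 0 := by rintro rfl; simp at hmn
  have h : Function.uncurry (pd2 f) = fun p => fderiv ℝ (Function.uncurry f) p (0, 1) :=
    funext fun p => (hasDerivAt_snd hf hn p.1 p.2).deriv
  rw [h]
  exact (hf.fderiv_right hmn).clm_apply contDiff_const

/-- The derivatives of a `C⁴` function entering the mass density and flux. -/
theorem hasDerivAt_density_flux {f : ℝ → ℝ → ℝ} (hf : ContDiff ℝ 4 (Function.uncurry f))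
    (x t : ℝ) :
    HasDerivAt (fun t' => pd2 f x t') (pd2 (pd2 f) x t) t ∧
    HasDerivAt (fun x' => pd1 f x' t) (pd1 (pd1 f) x t) x ∧
    HasDerivAt (fun x' => pd1 (pd2 (pd2 f)) x' t) (pd1 (pd1 (pd2 (pd2 f))) x t) x := by
  have h2 : ContDiff ℝ 3 (Function.uncurry (pd2 f)) :=
    contDiff_uncurry_pd2 hf (by norm_num)
  have h1 : ContDiff ℝ 3 (Function.uncurry (pd1 f)) :=
    contDiff_uncurry_pd1 hf (by norm_num)
  have h22 : ContDiff ℝ 2 (Function.uncurry (pd2 (pd2 f))) :=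
    contDiff_uncurry_pd2 h2 (by norm_num)
  have h122 : ContDiff ℝ 1 (Function.uncurry (pd1 (pd2 (pd2 f)))) :=
    contDiff_uncurry_pd1 h22 (by norm_num)
  exact ⟨hasDerivAt_pd2 h2 (by norm_num) x t, hasDerivAt_pd1 h1 (by norm_num) x t,
    hasDerivAt_pd1 h122 (by norm_num) x t⟩

/-- Local mass conservation law for C⁴ solutions of the potential coupled
Boussinesq system:
`∂_t(U_t + (δ/γ)W_t) − ∂_x(U_x + (δc²/γ)W_x + (ε/2)U_x² + (εαδ/(2γ))W_x² + εU_ttx + (εβδ/γ)W_ttx) = 0`. -/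
theorem stmt7 (α β γ δ c ε : ℝ) (hγ : γ ≠ 0) (U W : ℝ → ℝ → ℝ)
    (hU : ContDiff ℝ 4 (Function.uncurry U)) (hW : ContDiff ℝ 4 (Function.uncurry W))
    (hsys : potCB α β γ δ c ε U W) :
    ∀ x t : ℝ,
      pd2 (fun x t => pd2 U x t + (δ / γ) * pd2 W x t) x t
        - pd1 (fun x t => pd1 U x t + (δ * c ^ 2 / γ) * pd1 W x t
            + (ε / 2) * (pd1 U x t) ^ 2 + (ε * α * δ / (2 * γ)) * (pd1 W x t) ^ 2
            + ε * pd1 (pd2 (pd2 U)) x t + (ε * β * δ / γ) * pd1 (pd2 (pd2 W)) x t) x t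
      = 0 := by
  intro x t
  obtain ⟨hUt, hUx, hUttx⟩ := hasDerivAt_density_flux hU x t
  obtain ⟨hWt, hWx, hWttx⟩ := hasDerivAt_density_flux hW x t
  obtain ⟨eqU, eqW⟩ := hsys x t
  have density := (hUt.add (hWt.const_mul (δ / γ))).deriv
  have flux := (((((hUx.add (hWx.const_mul (δ * c ^ 2 / γ))).add
    ((hUx.pow 2).const_mul (ε / 2))).add
    ((hWx.pow 2).const_mul (ε * α * δ / (2 * γ)))).add
    (hUttx.const_mul ε)).add (hWttx.const_mul (ε * β * δ / γ))).deriv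
  refine (congrArg₂ (· - ·) density flux).trans ?_
  rw [sub_eq_iff_eq_add] at eqU eqW
  simp only [eqU, eqW]
  field_simp
  push_cast
  ring
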